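/- For every fixed friction Reynolds number Re > 0, the channel-flow fractional order α(y) = tanh((6.907/y)^{1.5}) + 0.908·(1 − tanh((6.907/y)^{1.5}))·y^{−0.175} + 0.418·exp(−(y/Re)^{−1.634})·y^{−0.175}, defined for y > 0, satisfies lim_{y→0⁺} α(y) = 1. -/

import Mathlib

open Filter Topology in
/-- Stretched-exponential decay in `c / y` beats every power of `y` as `y → 0⁺`. -/
theorem tendsto_exp_neg_div_rpow_mul_rpow_nhdsGT_zero {c p : ℝ} (hc : 0 < c) (hp : 0 < p)
    (s : ℝ) :
    Tendsto (fun y : ℝ => Real.exp (-(c / y) ^ p) * y ^ (-s)) (𝓝[>] 0) (𝓝 0) := by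
  have hu : Tendsto (fun y : ℝ => (c / y) ^ p) (𝓝[>] 0) atTop := by
    refine (tendsto_rpow_atTop hp).comp ?_
    exact (tendsto_inv_nhdsGT_zero.const_mul_atTop hc).congr fun y => (div_eq_mul_inv c y).symm
  have h := ((tendsto_rpow_mul_exp_neg_mul_atTop_nhds_zero (s / p) 1 one_pos).comp hu).const_mul
    (c ^ (-s))
  rw [mul_zero] at h
  refine h.congr' ?_
  filter_upwards [self_mem_nhdsWithin] with y (hy : 0 < y)
  have hpow : c ^ (-s) * ((c / y) ^ p) ^ (s / p) = y ^ (-s) := by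
    rw [← Real.rpow_mul (by positivity), mul_div_cancel₀ _ hp.ne', Real.div_rpow hc.le hy.le,
      Real.rpow_neg hc.le, Real.rpow_neg hy.le]
    have := (Real.rpow_pos_of_pos hc s).ne'
    field_simp
  simp only [Function.comp_apply, neg_mul, one_mul]
  rw [← mul_assoc, hpow, mul_comm]

theorem one_sub_tanh_le_two_mul_exp_neg {u : ℝ} (hu : 0 ≤ u) :
    1 - Real.tanh u ≤ 2 * Real.exp (-u) := by
  have h1 : 1 ≤ Real.exp u := Real.one_le_exp hu
  have h2 := Real.exp_pos (-u)
  rw [Real.tanh_eq, one_sub_div (by positivity), div_le_iff₀ (by positivity)]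
  nlinarith

open Filter Topology in
theorem tendsto_one_sub_tanh_div_rpow_mul_rpow_nhdsGT_zero {c p : ℝ} (hc : 0 < c) (hp : 0 < p)
    (s : ℝ) :
    Tendsto (fun y : ℝ => (1 - Real.tanh ((c / y) ^ p)) * y ^ (-s)) (𝓝[>] 0) (𝓝 0) := by
  have h := (tendsto_exp_neg_div_rpow_mul_rpow_nhdsGT_zero hc hp s).const_mul 2
  rw [mul_zero] at h
  refine squeeze_zero' ?_ ?_ h
  · filter_upwards [self_mem_nhdsWithin] with y (hy : 0 < y)
    exact mul_nonneg (sub_nonneg.2 (Real.tanh_lt_one _).le) (by positivity)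
  · filter_upwards [self_mem_nhdsWithin] with y (hy : 0 < y)
    rw [← mul_assoc]
    gcongr
    exact one_sub_tanh_le_two_mul_exp_neg (by positivity)

/-- For every fixed friction Reynolds number `Re > 0`, the channel-flow fractional order
tends to `1` as `y → 0⁺`. -/
theorem channel_fractional_order_tendsto_one_at_wall (Re : ℝ) (hRe : 0 < Re) :
    Filter.Tendsto
      (fun y : ℝ =>
        Real.tanh ((6.907 / y) ^ (1.5 : ℝ)) +
          0.908 * (1 - Real.tanh ((6.907 / y) ^ (1.5 : ℝ))) * y ^ (-0.175 : ℝ) +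
          0.418 * Real.exp (-(y / Re) ^ (-1.634 : ℝ)) * y ^ (-0.175 : ℝ))
      (nhdsWithin 0 (Set.Ioi 0)) (nhds 1) := by
  have htanh (s : ℝ) := tendsto_one_sub_tanh_div_rpow_mul_rpow_nhdsGT_zero
    (c := 6.907) (p := 1.5) (by norm_num) (by norm_num) s
  have hexp := tendsto_exp_neg_div_rpow_mul_rpow_nhdsGT_zero hRe
    (p := 1.634) (by norm_num) 0.175
  have h := (((htanh 0).const_sub 1).add ((htanh 0.175).const_mul 0.908)).add
    (hexp.const_mul 0.418)
  simp only [mul_zero, sub_zero, add_zero] at h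
  refine h.congr' ?_
  filter_upwards [self_mem_nhdsWithin] with y (hy : 0 < y)
  have hinv : (y / Re) ^ (-1.634 : ℝ) = (Re / y) ^ (1.634 : ℝ) := by
    rw [Real.rpow_neg (by positivity), ← Real.inv_rpow (by positivity), inv_div]
  rw [hinv, neg_zero, Real.rpow_zero]
  ring
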